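/- Let (X, π) be an n-partite weighted simplicial complex of rank n, let 0 ≤ ℓ ≤ n, and let H be a k-regular labelled graph on the vertex set of all ℓ-element subsets of [n]. Then the expanderized up-down walk Papx = UpDown_{ℓ↔n}(X, π, H) and the usual up-down walk Udw_{ℓ↔n} = Up_{ℓ→n}·Down_{n→ℓ} satisfy ‖Papx − (1 − λ(H))·Udw_{ℓ↔n}‖_{op, π_ℓ} ≤ λ(H), where λ(H) is the two-sided expansion of H. -/

import Mathlib

open scoped Classical
noncomputable section

namespace Expanderized

/-! ## Generic weighted linear algebra over finite types -/

section Generic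

variable {α β γ : Type*}

/-- Inner product `⟨f,g⟩_μ = E_{x∼μ}[f(x)g(x)]` with respect to a weight `μ`. -/
def inner' [Fintype α] (μ : α → ℝ) (f g : α → ℝ) : ℝ := ∑ x, μ x * (f x * g x)

/-- Expectation with respect to `μ`. -/
def expect [Fintype α] (μ : α → ℝ) (f : α → ℝ) : ℝ := ∑ x, μ x * f x

/-- `μ` is a probability distribution. -/
def IsProbDist [Fintype α] (μ : α → ℝ) : Prop := (∀ x, 0 ≤ μ x) ∧ (∑ x, μ x) = 1

/-- A row-stochastic kernel. -/
def IsRowStochastic [Fintype β] (P : α → β → ℝ) : Prop :=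
  (∀ x y, 0 ≤ P x y) ∧ ∀ x, (∑ y, P x y) = 1

/-- Product of two kernels (matrix multiplication). -/
def matMul [Fintype β] (A : α → β → ℝ) (B : β → γ → ℝ) : α → γ → ℝ :=
  fun x z => ∑ y, A x y * B y z

/-- Right action of a kernel on a function (column vector). -/
def mApp [Fintype β] (A : α → β → ℝ) (f : β → ℝ) : α → ℝ :=
  fun x => ∑ y, A x y * f y

/-- Left action of a kernel on a row vector / measure. -/
def rowMul [Fintype α] (μ : α → ℝ) (A : α → β → ℝ) : β → ℝ :=
  fun y => ∑ x, μ x * A x y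

/-- The adjoint of the kernel `P` with respect to the measures `(μ₁, μ₂)`. -/
def adjointKer [Fintype α] [Fintype β] (μ₁ : α → ℝ) (μ₂ : β → ℝ) (P : α → β → ℝ) :
    β → α → ℝ :=
  fun y x => P x y * μ₁ x / μ₂ y

/-- Iterates of a square kernel. -/
def matIter [Fintype α] [DecidableEq α] (A : α → α → ℝ) : ℕ → (α → α → ℝ)
  | 0 => fun x y => if x = y then 1 else 0
  | (t + 1) => matMul (matIter A t) A

/-- The second-largest eigenvalue `λ₂` of a random walk matrix that is reversible
with respect to `μ`, via its Rayleigh-quotient (Courant–Fischer) characterization. -/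
def lambda2 [Fintype α] (μ : α → ℝ) (A : α → α → ℝ) : ℝ :=
  sSup {r | ∃ f : α → ℝ, inner' μ f f = 1 ∧ inner' μ f (fun _ => 1) = 0 ∧
      r = inner' μ f (mApp A f)}

/-- The spectral gap `1 - λ₂`. -/
def specGap [Fintype α] (μ : α → ℝ) (A : α → α → ℝ) : ℝ := 1 - lambda2 μ A

/-- The two-sided expansion `λ(A) = max(λ₂(A), |λ_min(A)|)` of a random walk matrix
reversible with respect to `μ`, via its Rayleigh-quotient characterization. -/
def twoSided [Fintype α] (μ : α → ℝ) (A : α → α → ℝ) : ℝ :=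
  sSup {r | ∃ f : α → ℝ, inner' μ f f = 1 ∧ inner' μ f (fun _ => 1) = 0 ∧
      r = |inner' μ f (mApp A f)|}

/-- The operator norm `‖A‖_{op,μ}`. -/
def opNorm [Fintype α] (μ : α → ℝ) (A : α → α → ℝ) : ℝ :=
  sSup {r | ∃ f : α → ℝ, inner' μ f f = 1 ∧
      r = Real.sqrt (inner' μ (mApp A f) (mApp A f))}

/-- The `Φ`-entropy functional `Ent^Φ_μ(f) = E_μ[Φ(f)] - Φ(E_μ f)`. -/
def phiEnt [Fintype α] (Φ : ℝ → ℝ) (μ : α → ℝ) (f : α → ℝ) : ℝ :=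
  expect μ (fun x => Φ (f x)) - Φ (expect μ f)

/-- `t ↦ t log t`; note `Real.log 0 = 0`, so the convention `0 log 0 = 0` is built in. -/
def nlog (t : ℝ) : ℝ := t * Real.log t

/-- The usual entropy functional `Ent_μ`. -/
def ent [Fintype α] (μ : α → ℝ) (f : α → ℝ) : ℝ := phiEnt nlog μ f

/-- The `Φ`-entropy contraction constant of a kernel `P` with respect to measures
`(μ₁, μ₂)`: the largest `C ≥ 0` such that `Ent^Φ_{μ₁}(Pf) ≤ (1-C)·Ent^Φ_{μ₂}(f)`
for all nonnegative `f`. -/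
def CFphi [Fintype α] [Fintype β] (Φ : ℝ → ℝ) (μ₁ : α → ℝ) (μ₂ : β → ℝ)
    (P : α → β → ℝ) : ℝ :=
  sSup {C | 0 ≤ C ∧ ∀ f : β → ℝ, (∀ y, 0 ≤ f y) →
      phiEnt Φ μ₁ (mApp P f) ≤ (1 - C) * phiEnt Φ μ₂ f}

/-- The entropy contraction constant `EC(P)`. -/
def EC [Fintype α] [Fintype β] (μ₁ : α → ℝ) (μ₂ : β → ℝ) (P : α → β → ℝ) : ℝ :=
  CFphi nlog μ₁ μ₂ P

/-- The log-Sobolev constant of a reversible kernel `P` with stationary measure `μ`: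
the largest `C ≥ 0` with `C·Ent_μ(f²) ≤ ⟨f,(I-P)f⟩_μ` for all nonnegative `f`. -/
def LS [Fintype α] (μ : α → ℝ) (P : α → α → ℝ) : ℝ :=
  sSup {C | 0 ≤ C ∧ ∀ f : α → ℝ, (∀ x, 0 ≤ f x) →
      C * ent μ (fun x => f x ^ 2) ≤ inner' μ f (fun x => f x - mApp P f x)}

/-- The modified log-Sobolev constant of a reversible kernel `P` with stationary
measure `μ`: the largest `C ≥ 0` with `C·Ent_μ(f) ≤ ⟨f,(I-P) log f⟩_μ`
for all strictly positive `f`. -/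
def MLS [Fintype α] (μ : α → ℝ) (P : α → α → ℝ) : ℝ :=
  sSup {C | 0 ≤ C ∧ ∀ f : α → ℝ, (∀ x, 0 < f x) →
      C * ent μ f ≤
        inner' μ f (fun x => Real.log (f x) - mApp P (fun y => Real.log (f y)) x)}

/-- Total variation distance. -/
def tvDist [Fintype α] (μ ν : α → ℝ) : ℝ := (∑ x, |μ x - ν x|) / 2

/-- The `ε`-mixing time of a kernel `P` towards the target distribution `π`. -/
def mixingTime [Fintype α] [DecidableEq α] (P : α → α → ℝ) (π : α → ℝ) (ε : ℝ) : ℕ :=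
  sInf {t : ℕ | ∀ μ₀ : α → ℝ, IsProbDist μ₀ → tvDist (rowMul μ₀ (matIter P t)) π ≤ ε}

end Generic

/-! ## Weighted simplicial complexes -/

/-- A weighted (pure) simplicial complex of rank `n` on a finite vertex set `V`:
a downward-closed collection of faces, all maximal faces of cardinality `n`,
together with a fully supported probability distribution `pi` on the rank `n` faces
(extended by zero to all finsets). -/
structure WComplex (V : Type*) [Fintype V] [DecidableEq V] (n : ℕ) where
  faces : Finset (Finset V)
  pi : Finset V → ℝ
  faces_nonempty : faces.Nonempty
  down_closed : ∀ α ∈ faces, ∀ β ⊆ α, β ∈ faces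
  card_le : ∀ α ∈ faces, α.card ≤ n
  pure : ∀ α ∈ faces, ∃ ω ∈ faces, ω.card = n ∧ α ⊆ ω
  pi_pos : ∀ ω ∈ faces, ω.card = n → 0 < pi ω
  pi_zero_of_not_mem : ∀ ω : Finset V, ω ∉ faces → pi ω = 0
  pi_zero_of_card_ne : ∀ ω : Finset V, ω.card ≠ n → pi ω = 0
  pi_sum : (∑ ω : Finset V, pi ω) = 1

namespace WComplex

variable {V : Type*} [Fintype V] [DecidableEq V] {n : ℕ}

/-- `Pr_{ω∼π}[ω ⊇ α]` (unnormalized level mass of a face). -/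
def mass (K : WComplex V n) (α : Finset V) : ℝ :=
  ∑ ω : Finset V, if α ⊆ ω then K.pi ω else 0

/-- The induced distribution `π_j` on the `j`-th level `X^(j)`. -/
def level (K : WComplex V n) (j : ℕ) : Finset V → ℝ :=
  fun α => if α.card = j then ((n.choose j : ℝ))⁻¹ * K.mass α else 0

/-- The up-walk `Up_{ℓ→k}`. -/
def up (K : WComplex V n) (ℓ k : ℕ) : Finset V → Finset V → ℝ :=
  fun a b =>
    if a.card = ℓ ∧ b.card = k ∧ a ⊆ b then
      (((n - ℓ).choose (k - ℓ) : ℝ))⁻¹ * (K.mass b / K.mass a)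
    else 0

/-- The down-walk `Down_{k→ℓ}`. -/
def down (K : WComplex V n) (k ℓ : ℕ) : Finset V → Finset V → ℝ :=
  fun a b => if a.card = k ∧ b.card = ℓ ∧ b ⊆ a then ((k.choose ℓ : ℝ))⁻¹ else 0

/-- The down-up walk `Duw_{n↔ℓ} = Down_{n→ℓ}·Up_{ℓ→n}` on `X^(n)`. -/
def downUp (K : WComplex V n) (ℓ : ℕ) : Finset V → Finset V → ℝ :=
  matMul (K.down n ℓ) (K.up ℓ n)

/-- The up-down walk `Udw_{ℓ↔n} = Up_{ℓ→n}·Down_{n→ℓ}` on `X^(ℓ)`. -/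
def upDown (K : WComplex V n) (ℓ : ℕ) : Finset V → Finset V → ℝ :=
  matMul (K.up ℓ n) (K.down n ℓ)

/-- The top-level distribution `π^(ω̂)` of the link complex of the face `z`. -/
def linkPi (K : WComplex V n) (z : Finset V) : Finset V → ℝ :=
  fun α => if Disjoint α z then K.pi (z ∪ α) / K.mass z else 0

/-- Unnormalized level mass in the link of `z`. -/
def linkMass (K : WComplex V n) (z α : Finset V) : ℝ :=
  ∑ β : Finset V, if α ⊆ β then K.linkPi z β else 0

/-- The induced distribution `π^(ω̂)_j` on the `j`-th level of the link of `z`. -/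
def linkLevel (K : WComplex V n) (z : Finset V) (j : ℕ) : Finset V → ℝ :=
  fun α => if α.card = j then (((n - z.card).choose j : ℝ))⁻¹ * K.linkMass z α else 0

/-- The up-walk `Up^{ω̂}_{ℓ→k}` of the link complex of `z`. -/
def linkUp (K : WComplex V n) (z : Finset V) (ℓ k : ℕ) : Finset V → Finset V → ℝ :=
  fun a b =>
    if a.card = ℓ ∧ b.card = k ∧ a ⊆ b then
      ((((n - z.card) - ℓ).choose (k - ℓ) : ℝ))⁻¹ * (K.linkMass z b / K.linkMass z a)
    else 0

/-- The vertex marginal `π^(ω̂)_1` of the link of `z`, as a distribution on vertices. -/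
def linkVertex (K : WComplex V n) (z : Finset V) : V → ℝ :=
  fun x => K.linkLevel z 1 {x}

/-- The link random-walk matrix `M_ω̂` of a face `z` (with `|z| ≤ n-2`). -/
def linkMat (K : WComplex V n) (z : Finset V) : V → V → ℝ :=
  fun x y =>
    if x ≠ y then (K.mass (z ∪ {x, y}) / K.mass (z ∪ {x})) / ((n : ℝ) - z.card - 1)
    else 0

/-- The local `Φ`-entropy contraction constant `lc_Φ(ω̂)`: the smallest `c ≥ 0` with
`Ent^Φ_{π^(ω̂)_1}(Up^{ω̂}_{1→n'} g) ≤ c·Ent^Φ_{π^(ω̂)_{n'}}(g)` for all `g ≥ 0`,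
where `n' = n - |ω̂|`. -/
def lcPhi (K : WComplex V n) (Φ : ℝ → ℝ) (z : Finset V) : ℝ :=
  sInf {c | 0 ≤ c ∧ ∀ g : Finset V → ℝ, (∀ x, 0 ≤ g x) →
      phiEnt Φ (K.linkLevel z 1) (mApp (K.linkUp z 1 (n - z.card)) g)
        ≤ c * phiEnt Φ (K.linkLevel z (n - z.card)) g}

/-- The local entropy contraction constant `lec(ω̂)` (the case `Φ(t) = t log t`). -/
def lec (K : WComplex V n) (z : Finset V) : ℝ := K.lcPhi nlog z

end WComplex

/-! ## Partite complexes, auxiliary expander graphs, and expanderized walks -/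

section Partite

variable {n : ℕ} {U : Type*} [Fintype U] [DecidableEq U]

/-- The type of a face of an `n`-partite complex: the set of sides it meets. -/
def typ (α : Finset (Fin n × U)) : Finset (Fin n) := α.image Prod.fst

/-- The restriction `ω_S` of a face to the sides in `S`. -/
def restrict (ω : Finset (Fin n × U)) (S : Finset (Fin n)) : Finset (Fin n × U) :=
  ω.filter fun v => v.1 ∈ S

/-- An `n`-partite complex: every facet contains exactly one vertex from each side. -/
def IsPartite (K : WComplex (Fin n × U) n) : Prop :=
  ∀ ω ∈ K.faces, ω.card = n → (typ ω).card = n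

/-- `H` is a `k`-regular graph all of whose edges join `ℓ`-element subsets of `[n]`. -/
def IsRegularOnSubsets (H : SimpleGraph (Finset (Fin n))) (ℓ k : ℕ) : Prop :=
  (∀ S T, H.Adj S T → S.card = ℓ ∧ T.card = ℓ) ∧
  (∀ S : Finset (Fin n), S.card = ℓ → (Finset.univ.filter fun T => H.Adj S T).card = k)

/-- The simple random walk matrix of a `k`-regular graph `H`. -/
def walkMat (H : SimpleGraph (Finset (Fin n))) (k : ℕ) :
    Finset (Fin n) → Finset (Fin n) → ℝ :=
  fun S T => if H.Adj S T then (k : ℝ)⁻¹ else 0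

/-- The uniform distribution on `ℓ`-element subsets of `[n]`. -/
def unifSubsets (n ℓ : ℕ) : Finset (Fin n) → ℝ :=
  fun S => if S.card = ℓ then ((n.choose ℓ : ℝ))⁻¹ else 0

/-- The two-sided expansion `λ(H)` of `H`. -/
def lamH (H : SimpleGraph (Finset (Fin n))) (ℓ k : ℕ) : ℝ :=
  twoSided (unifSubsets n ℓ) (walkMat H k)

/-- The two-sided expansion `λ(H²)` of the square of `H` (i.e. of the graph whose
random walk matrix is the square of that of `H`). -/
def lamHsq (H : SimpleGraph (Finset (Fin n))) (ℓ k : ℕ) : ℝ :=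
  twoSided (unifSubsets n ℓ) (matMul (walkMat H k) (walkMat H k))

/-- `Pr_{ω∼π}[ω_{typ a} = a ∧ ω_{typ b} = b]`. -/
def jointMass (K : WComplex (Fin n × U) n) (a b : Finset (Fin n × U)) : ℝ :=
  ∑ ω : Finset (Fin n × U),
    if restrict ω (typ a) = a ∧ restrict ω (typ b) = b then K.pi ω else 0

/-- The expanderized up-down walk with type-transition matrix `W`; taking
`W = walkMat H k` gives `UpDown(X, π, H)`, and taking `W = (walkMat H k)²`
gives `UpDown(X, π, H²)`.  Its `(ω̂, ω̃)` entry is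
`W(typ ω̂, typ ω̃) · Pr_{ω∼π}[ω_{typ ω̃} = ω̃ ∣ ω_{typ ω̂} = ω̂]`. -/
def expUpDown (K : WComplex (Fin n × U) n)
    (W : Finset (Fin n) → Finset (Fin n) → ℝ) :
    Finset (Fin n × U) → Finset (Fin n × U) → ℝ :=
  fun a b => W (typ a) (typ b) * (jointMass K a b / jointMass K a a)

/-- The expanderized down-walk `Qdo` from `X^(n) × binom([n],ℓ)` to `X^(ℓ)`. -/
def Qdown (K : WComplex (Fin n × U) n) (H : SimpleGraph (Finset (Fin n))) (k : ℕ) :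
    Finset (Fin n × U) × Finset (Fin n) → Finset (Fin n × U) → ℝ :=
  fun p b => if H.Adj p.2 (typ b) ∧ b ⊆ p.1 then (k : ℝ)⁻¹ else 0

/-- The expanderized up-walk `Qup` from `X^(ℓ)` to `X^(n) × binom([n],ℓ)`
(the adjoint of `Qdown` with respect to `(π_n ⊗ Unif, π_ℓ)`). -/
def Qup (K : WComplex (Fin n × U) n) (H : SimpleGraph (Finset (Fin n))) (k : ℕ) :
    Finset (Fin n × U) → Finset (Fin n × U) × Finset (Fin n) → ℝ :=
  fun b p =>
    (if H.Adj p.2 (typ b) then (k : ℝ)⁻¹ else 0) *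
      ((if b ⊆ p.1 then K.pi p.1 else 0) / K.mass b)

/-- The expanderized down-up walk `Paqx = Qdo·Qup` on `X^(n) × binom([n],ℓ)`. -/
def expDownUp (K : WComplex (Fin n × U) n) (H : SimpleGraph (Finset (Fin n))) (k : ℕ) :
    Finset (Fin n × U) × Finset (Fin n) → Finset (Fin n × U) × Finset (Fin n) → ℝ :=
  matMul (Qdown K H k) (Qup K H k)

/-- The product distribution `π_n ⊗ Unif_{binom([n],ℓ)}`. -/
def prodDist (K : WComplex (Fin n × U) n) (ℓ : ℕ) :
    Finset (Fin n × U) × Finset (Fin n) → ℝ :=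
  fun p => K.pi p.1 * unifSubsets n ℓ p.2

end Partite

/-! ## List colorings -/

section Coloring

variable {n : ℕ} {Col : Type*} [Fintype Col] [DecidableEq Col]

/-- The degree of a vertex in a graph. -/
def degree' {W : Type*} [Fintype W] (G : SimpleGraph W) (v : W) : ℕ :=
  (Finset.univ.filter fun u => G.Adj v u).card

/-- A proper list coloring of `(G, L)`. -/
def IsProperColoring (G : SimpleGraph (Fin n)) (L : Fin n → Finset Col)
    (c : Fin n → Col) : Prop :=
  (∀ v, c v ∈ L v) ∧ ∀ u v, G.Adj u v → c u ≠ c v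

/-- The face `{(v, c v) : v}` associated to a coloring `c`. -/
def colorFace (c : Fin n → Col) : Finset (Fin n × Col) :=
  Finset.univ.image fun v => (v, c v)

/-- `Y` is the list-coloring complex of `(G, L)`: its faces are the subsets of proper
list colorings and its weight is the uniform distribution on proper list colorings. -/
def IsColoringComplex (G : SimpleGraph (Fin n)) (L : Fin n → Finset Col)
    (Y : WComplex (Fin n × Col) n) : Prop :=
  (∀ α : Finset (Fin n × Col),
      α ∈ Y.faces ↔ ∃ c : Fin n → Col, IsProperColoring G L c ∧ α ⊆ colorFace c) ∧
  (∀ ω : Finset (Fin n × Col),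
      Y.pi ω =
        ∑ c : Fin n → Col,
          if IsProperColoring G L c ∧ ω = colorFace c then
            ((Finset.univ.filter fun c' : Fin n → Col =>
                IsProperColoring G L c').card : ℝ)⁻¹
          else 0)

end Coloring

/-! ## Ising models -/

section Ising

variable {n : ℕ}

/-- `±1` value of a Boolean spin. -/
def signR (b : Bool) : ℝ := if b then 1 else -1

/-- The (unnormalized) Ising weight `exp(½⟨x,Jx⟩ + ⟨h,x⟩)`. -/
def isingWeight (J : Matrix (Fin n) (Fin n) ℝ) (h : Fin n → ℝ) (x : Fin n → Bool) : ℝ :=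
  Real.exp ((1 / 2) * (∑ i, ∑ j, J i j * (signR (x i) * signR (x j))) +
    ∑ i, h i * signR (x i))

/-- The face `{(i, x i) : i}` associated to a spin configuration `x`. -/
def spinFace (x : Fin n → Bool) : Finset (Fin n × Bool) :=
  Finset.univ.image fun i => (i, x i)

/-- `Y` is the Ising complex of `(J, h)`. -/
def IsIsingComplex (J : Matrix (Fin n) (Fin n) ℝ) (h : Fin n → ℝ)
    (Y : WComplex (Fin n × Bool) n) : Prop :=
  (∀ α : Finset (Fin n × Bool), α ∈ Y.faces ↔ ∃ x : Fin n → Bool, α ⊆ spinFace x) ∧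
  (∀ ω : Finset (Fin n × Bool),
      Y.pi ω =
        (∑ x : Fin n → Bool, if ω = spinFace x then isingWeight J h x else 0) /
          ∑ x : Fin n → Bool, isingWeight J h x)

/-- The `ℓ₂ → ℓ₂` operator norm of a square matrix. -/
def matOpNorm {m : ℕ} (J : Matrix (Fin m) (Fin m) ℝ) : ℝ :=
  sSup {r | ∃ v : Fin m → ℝ, (∑ i, v i ^ 2) = 1 ∧
      r = Real.sqrt (∑ i, (J.mulVec v i) ^ 2)}

/-- The `2×2` principal submatrix of `J` at rows/columns `i, j`. -/
def principal2 (J : Matrix (Fin n) (Fin n) ℝ) (i j : Fin n) : Matrix (Fin 2) (Fin 2) ℝ :=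
  !![J i i, J i j; J j i, J j j]

/-- `‖h‖_∞`. -/
def normInf (h : Fin n → ℝ) : ℝ := sSup (Set.range fun i => |h i|)

/-- `‖h‖_₁`. -/
def norm1 (h : Fin n → ℝ) : ℝ := ∑ i, |h i|

end Ising

end Expanderized

namespace Expanderized

section Reversible

variable {α : Type*} [Fintype α] {μ : α → ℝ} {P : α → α → ℝ}

lemma inner'_mApp (f g : α → ℝ) :
    inner' μ f (mApp P g) = ∑ x, ∑ y, μ x * P x y * (f x * g y) := by
  unfold inner' mApp
  refine Finset.sum_congr rfl fun x _ => ?_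
  rw [Finset.mul_sum, Finset.mul_sum]
  exact Finset.sum_congr rfl fun y _ => by ring

lemma sum_mul_row (hrow : ∀ x, μ x ≠ 0 → ∑ y, P x y = 1) (x : α) :
    ∑ y, μ x * P x y = μ x := by
  rw [← Finset.mul_sum]
  by_cases hx : μ x = 0
  · simp [hx]
  · rw [hrow x hx, mul_one]

lemma inner'_self_nonneg (hμ : ∀ x, 0 ≤ μ x) (f : α → ℝ) : 0 ≤ inner' μ f f :=
  Finset.sum_nonneg fun x _ => mul_nonneg (hμ x) (mul_self_nonneg _)

lemma inner'_smul_smul (c d : ℝ) (f g : α → ℝ) :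
    inner' μ (fun x => c * f x) (fun x => d * g x) = c * d * inner' μ f g := by
  unfold inner'
  rw [Finset.mul_sum]
  exact Finset.sum_congr rfl fun x _ => by ring

lemma mApp_smul (c : ℝ) (f : α → ℝ) :
    mApp P (fun x => c * f x) = fun x => c * mApp P f x := by
  funext x
  unfold mApp
  rw [Finset.mul_sum]
  exact Finset.sum_congr rfl fun y _ => by ring

/-- A reversible random walk is a contraction in the sense of quadratic forms. -/
lemma abs_inner'_mApp_le (hμ : ∀ x, 0 ≤ μ x) (hP : ∀ x y, 0 ≤ P x y)
    (hrev : ∀ x y, μ x * P x y = μ y * P y x)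
    (hrow : ∀ x, μ x ≠ 0 → ∑ y, P x y = 1) (f : α → ℝ) :
    |inner' μ f (mApp P f)| ≤ inner' μ f f := by
  have h1 : ∑ x, ∑ y, μ x * P x y * (f x * f x) = inner' μ f f := by
    unfold inner'
    exact Finset.sum_congr rfl fun x _ => by rw [← Finset.sum_mul, sum_mul_row hrow]
  have h2 : ∑ x, ∑ y, μ x * P x y * (f y * f y) = inner' μ f f := by
    rw [Finset.sum_comm, ← h1]
    exact Finset.sum_congr rfl fun x _ => Finset.sum_congr rfl fun y _ => by rw [hrev]
  have h3 : ∑ x, ∑ y, μ x * P x y * ((f x * f x + f y * f y) / 2) = inner' μ f f := by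
    have : ∀ x y, μ x * P x y * ((f x * f x + f y * f y) / 2) =
        2⁻¹ * (μ x * P x y * (f x * f x)) + 2⁻¹ * (μ x * P x y * (f y * f y)) :=
      fun x y => by ring
    simp_rw [this, Finset.sum_add_distrib, ← Finset.mul_sum]
    rw [h1, h2]
    ring
  rw [inner'_mApp, ← h3]
  refine (Finset.abs_sum_le_sum_abs _ _).trans (Finset.sum_le_sum fun x _ =>
    (Finset.abs_sum_le_sum_abs _ _).trans (Finset.sum_le_sum fun y _ => ?_))
  have hw : 0 ≤ μ x * P x y := mul_nonneg (hμ x) (hP x y)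
  rw [abs_mul, abs_of_nonneg hw]
  refine mul_le_mul_of_nonneg_left (abs_le.2 ⟨?_, ?_⟩) hw
  · nlinarith [sq_nonneg (f x + f y)]
  · nlinarith [sq_nonneg (f x - f y)]

lemma twoSided_nonneg : 0 ≤ twoSided μ P := by
  refine Real.sSup_nonneg ?_
  rintro r ⟨f, -, -, rfl⟩
  exact abs_nonneg _

lemma abs_inner'_mApp_le_twoSided (hμ : ∀ x, 0 ≤ μ x) (hP : ∀ x y, 0 ≤ P x y)
    (hrev : ∀ x y, μ x * P x y = μ y * P y x)
    (hrow : ∀ x, μ x ≠ 0 → ∑ y, P x y = 1) (f : α → ℝ)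
    (hf : inner' μ f (fun _ => 1) = 0) :
    |inner' μ f (mApp P f)| ≤ twoSided μ P * inner' μ f f := by
  have hle := abs_inner'_mApp_le hμ hP hrev hrow
  rcases (inner'_self_nonneg hμ f).eq_or_lt with h0 | hpos
  · simpa [← h0] using hle f
  · set s := inner' μ f f with hs
    have hsq : (√s)⁻¹ * (√s)⁻¹ = s⁻¹ := by
      rw [← mul_inv, Real.mul_self_sqrt hpos.le]
    have hmem : s⁻¹ * |inner' μ f (mApp P f)| ≤ twoSided μ P := by
      refine le_csSup ⟨1, ?_⟩ ⟨fun x => (√s)⁻¹ * f x, ?_, ?_, ?_⟩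
      · rintro r ⟨g, hg, -, rfl⟩
        exact (hle g).trans hg.le
      · rw [inner'_smul_smul, hsq, ← hs, inv_mul_cancel₀ hpos.ne']
      · simpa [hf] using inner'_smul_smul (μ := μ) (√s)⁻¹ 1 f (fun _ => 1)
      · rw [mApp_smul, inner'_smul_smul, hsq, abs_mul, abs_of_pos (inv_pos.2 hpos)]
    rwa [inv_mul_le_iff₀ hpos, mul_comm] at hmem

/-- The quadratic form of `P - (1 - λ)J`, with `J` the averaging operator, is bounded by `λ`. -/
lemma abs_inner'_mApp_sub_le (hμ : ∀ x, 0 ≤ μ x) (hμ1 : ∑ x, μ x = 1)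
    (hP : ∀ x y, 0 ≤ P x y) (hrev : ∀ x y, μ x * P x y = μ y * P y x)
    (hrow : ∀ x, μ x ≠ 0 → ∑ y, P x y = 1) (f : α → ℝ) :
    |inner' μ f (mApp P f) - (1 - twoSided μ P) * (expect μ f * expect μ f)| ≤
      twoSided μ P * inner' μ f f := by
  set m := expect μ f with hm
  have hcol (g : α → ℝ) : ∑ x, ∑ y, μ x * P x y * g y = expect μ g := by
    rw [Finset.sum_comm]
    refine Finset.sum_congr rfl fun y _ => ?_
    rw [← Finset.sum_mul, ← sum_mul_row hrow y]
    simp_rw [hrev y]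
  have hrow' (g : α → ℝ) : ∑ x, ∑ y, μ x * P x y * g x = expect μ g :=
    Finset.sum_congr rfl fun x _ => by rw [← Finset.sum_mul, sum_mul_row hrow]
  have hone : ∑ x, ∑ y, μ x * P x y = 1 := by
    simp_rw [sum_mul_row hrow, hμ1]
  have hmean : inner' μ (fun x => f x - m) (fun _ => 1) = 0 := by
    simp only [inner', mul_one, mul_sub, Finset.sum_sub_distrib, ← Finset.sum_mul, hμ1]
    simp [hm, expect]
  have hP' : inner' μ (fun x => f x - m) (mApp P fun x => f x - m) =
      inner' μ f (mApp P f) - m * m := by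
    rw [inner'_mApp, inner'_mApp]
    have : ∀ x y, μ x * P x y * ((f x - m) * (f y - m)) = μ x * P x y * (f x * f y)
        - m * (μ x * P x y * f y) - m * (μ x * P x y * f x) + m * m * (μ x * P x y) :=
      fun x y => by ring
    simp_rw [this, Finset.sum_add_distrib, Finset.sum_sub_distrib, ← Finset.mul_sum]
    simp_rw [Finset.mul_sum _ (P _), hcol, hrow', hone, ← hm]
    ring
  have hnorm : inner' μ (fun x => f x - m) (fun x => f x - m) = inner' μ f f - m * m := by
    unfold inner'
    have : ∀ x, μ x * ((f x - m) * (f x - m)) =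
        μ x * (f x * f x) - 2 * m * (μ x * f x) + m * m * μ x := fun x => by ring
    simp_rw [this, Finset.sum_add_distrib, Finset.sum_sub_distrib, ← Finset.mul_sum]
    rw [hμ1, show ∑ x, μ x * f x = m from rfl]
    ring
  have key := abs_inner'_mApp_le_twoSided hμ hP hrev hrow _ hmean
  rw [hP', hnorm, abs_le] at key
  have hl : 0 ≤ twoSided μ P * (m * m) := mul_nonneg twoSided_nonneg (mul_self_nonneg m)
  rw [abs_le]
  constructor <;> nlinarith [key.1, key.2]

/-- A symmetric bilinear form whose quadratic form is bounded by `c` has operator norm at most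
`c`. -/
lemma opNorm_le_of_quadratic {c : ℝ} (hc : 0 ≤ c) (hμ : ∀ x, 0 ≤ μ x)
    (hsymm : ∀ f g, inner' μ f (mApp P g) = inner' μ g (mApp P f))
    (hquad : ∀ f, |inner' μ f (mApp P f)| ≤ c * inner' μ f f) : opNorm μ P ≤ c := by
  refine Real.sSup_le ?_ hc
  rintro r ⟨f, hf, rfl⟩
  set N := inner' μ (mApp P f) (mApp P f) with hN
  have hN0 : 0 ≤ N := inner'_self_nonneg hμ _
  have main (t : ℝ) : 4 * (t * N) ≤ 2 * c * (1 + t * t * N) := by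
    let g : α → ℝ := fun x => t * mApp P f x
    have hgf : inner' μ g (mApp P f) = t * N := by
      simpa using inner'_smul_smul (μ := μ) t 1 (mApp P f) (mApp P f)
    have hgg : inner' μ g g = t * t * N := inner'_smul_smul _ _ _ _
    have hp := (abs_le.1 (hquad fun x => f x + g x)).2
    have hq := (abs_le.1 (hquad fun x => f x - g x)).1
    have e1 : inner' μ (fun x => f x + g x) (mApp P fun x => f x + g x) -
        inner' μ (fun x => f x - g x) (mApp P fun x => f x - g x) =
        2 * inner' μ f (mApp P g) + 2 * inner' μ g (mApp P f) := by
      simp only [inner'_mApp, Finset.mul_sum, ← Finset.sum_add_distrib,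
        ← Finset.sum_sub_distrib]
      exact Finset.sum_congr rfl fun x _ => Finset.sum_congr rfl fun y _ => by ring
    have e2 : inner' μ (fun x => f x + g x) (fun x => f x + g x) +
        inner' μ (fun x => f x - g x) (fun x => f x - g x) =
        2 * inner' μ f f + 2 * inner' μ g g := by
      simp only [inner', Finset.mul_sum, ← Finset.sum_add_distrib]
      exact Finset.sum_congr rfl fun x _ => by ring
    rw [hsymm f g, hgf] at e1
    rw [hf, hgg] at e2
    have e3 := congrArg (c * ·) e2
    simp only [mul_add] at e3
    linarith
  rw [Real.sqrt_le_left hc]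
  rcases hc.eq_or_lt with rfl | hpos
  · nlinarith [main 1]
  · have h := main c⁻¹
    have e : c * (c⁻¹ * c⁻¹ * N) = c⁻¹ * N := by field_simp
    have h' : c⁻¹ * N ≤ c := by nlinarith
    rw [inv_mul_le_iff₀ hpos] at h'
    nlinarith

end Reversible

section Facets

variable {n : ℕ} {U : Type*} [Fintype U] [DecidableEq U] {K : WComplex (Fin n × U) n}

lemma pi_nonneg (K : WComplex (Fin n × U) n) (ω : Finset (Fin n × U)) : 0 ≤ K.pi ω := by
  by_cases h : ω ∈ K.faces
  · by_cases hc : ω.card = n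
    · exact (K.pi_pos ω h hc).le
    · exact (K.pi_zero_of_card_ne ω hc).ge
  · exact (K.pi_zero_of_not_mem ω h).ge

lemma mem_faces_of_pi_ne_zero {ω : Finset (Fin n × U)} (h : K.pi ω ≠ 0) : ω ∈ K.faces :=
  not_imp_comm.1 (K.pi_zero_of_not_mem ω) h

lemma card_of_pi_ne_zero {ω : Finset (Fin n × U)} (h : K.pi ω ≠ 0) : ω.card = n :=
  not_imp_comm.1 (K.pi_zero_of_card_ne ω) h

lemma injOn_fst_of_pi_ne_zero (hpart : IsPartite K) {ω : Finset (Fin n × U)}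
    (h : K.pi ω ≠ 0) : Set.InjOn Prod.fst (ω : Set (Fin n × U)) := by
  exact Finset.card_image_iff.1
    ((hpart ω (mem_faces_of_pi_ne_zero h) (card_of_pi_ne_zero h)).trans (card_of_pi_ne_zero h).symm)

lemma exists_mem_of_pi_ne_zero (hpart : IsPartite K) {ω : Finset (Fin n × U)}
    (h : K.pi ω ≠ 0) (i : Fin n) : ∃ u, (i, u) ∈ ω := by
  have hu : typ ω = Finset.univ := by
    rw [← Finset.card_eq_iff_eq_univ, Fintype.card_fin]
    exact hpart ω (mem_faces_of_pi_ne_zero h) (card_of_pi_ne_zero h)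
  have hi : i ∈ typ ω := hu ▸ Finset.mem_univ i
  simpa [typ] using hi

lemma typ_restrict (hpart : IsPartite K) {ω : Finset (Fin n × U)}
    (h : K.pi ω ≠ 0) (S : Finset (Fin n)) : typ (restrict ω S) = S := by
  ext i
  have := exists_mem_of_pi_ne_zero hpart h i
  simp only [typ, restrict, Finset.mem_image, Finset.mem_filter, Prod.exists]
  aesop

lemma card_restrict (hpart : IsPartite K) {ω : Finset (Fin n × U)}
    (h : K.pi ω ≠ 0) (S : Finset (Fin n)) : (restrict ω S).card = S.card := by
  conv_rhs => rw [← typ_restrict hpart h S]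
  refine (Finset.card_image_of_injOn ?_).symm
  exact (injOn_fst_of_pi_ne_zero hpart h).mono fun x hx => (Finset.mem_filter.1 hx).1

lemma restrict_typ_eq_iff (hpart : IsPartite K) {ω : Finset (Fin n × U)}
    (h : K.pi ω ≠ 0) (a : Finset (Fin n × U)) : restrict ω (typ a) = a ↔ a ⊆ ω := by
  constructor
  · intro e
    rw [← e]
    exact Finset.filter_subset _ _
  · intro ha
    ext x
    simp only [restrict, typ, Finset.mem_filter, Finset.mem_image]
    constructor
    · rintro ⟨hx, y, hy, hxy⟩
      rwa [← injOn_fst_of_pi_ne_zero hpart h (ha hy) hx hxy]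
    · exact fun hx => ⟨ha hx, x, hx, rfl⟩

/-- The faces contained in a facet are exactly its restrictions to sets of sides. -/
lemma pi_mul_sum_subset (hpart : IsPartite K) (ω : Finset (Fin n × U))
    (φ : Finset (Fin n × U) → ℝ) :
    K.pi ω * ∑ b, (if b ⊆ ω then φ b else 0) = K.pi ω * ∑ S, φ (restrict ω S) := by
  by_cases h : K.pi ω = 0
  · simp [h]
  congr 1
  rw [← Finset.sum_filter]
  refine Finset.sum_nbij' typ (restrict ω) (by simp) ?_ ?_ ?_ ?_
  · intro S _
    simp [restrict]
  · intro a ha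
    exact (restrict_typ_eq_iff hpart h a).2 (by simpa using ha)
  · intro S _
    exact typ_restrict hpart h S
  · intro a ha
    rw [(restrict_typ_eq_iff hpart h a).2 (by simpa using ha)]

lemma jointMass_eq (hpart : IsPartite K) (a b : Finset (Fin n × U)) :
    jointMass K a b = ∑ ω, if a ⊆ ω ∧ b ⊆ ω then K.pi ω else 0 := by
  refine Finset.sum_congr rfl fun ω _ => ?_
  by_cases h : K.pi ω = 0
  · simp [h]
  · simp only [restrict_typ_eq_iff hpart h]

lemma jointMass_self (hpart : IsPartite K) (a : Finset (Fin n × U)) :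
    jointMass K a a = K.mass a := by
  rw [jointMass_eq hpart]
  simp only [and_self, WComplex.mass]

lemma pi_eq_zero_of_mass_eq_zero {a ω : Finset (Fin n × U)} (h : K.mass a = 0)
    (ha : a ⊆ ω) : K.pi ω = 0 := by
  have := (Finset.sum_eq_zero_iff_of_nonneg fun τ _ => by
    split_ifs <;> simp [pi_nonneg]).1 h ω (Finset.mem_univ ω)
  simpa [ha] using this

lemma mass_nonneg (a : Finset (Fin n × U)) : 0 ≤ K.mass a :=
  Finset.sum_nonneg fun τ _ => by split_ifs <;> simp [pi_nonneg]

lemma level_nonneg (ℓ : ℕ) (a : Finset (Fin n × U)) : 0 ≤ K.level ℓ a := by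
  unfold WComplex.level
  split_ifs
  · exact mul_nonneg (by positivity) (mass_nonneg a)
  · exact le_rfl

lemma mass_of_card_eq {ω : Finset (Fin n × U)} (h : ω.card = n) : K.mass ω = K.pi ω := by
  unfold WComplex.mass
  rw [Finset.sum_eq_single ω]
  · simp
  · intro τ _ hne
    split_ifs with hs
    · refine K.pi_zero_of_card_ne τ fun hc => hne ?_
      exact (Finset.eq_of_subset_of_card_le hs (by omega)).symm
    · rfl
  · simp

lemma mass_mul_jointMass_div (hpart : IsPartite K) (a b : Finset (Fin n × U)) :
    K.mass a * (jointMass K a b / jointMass K a a) = jointMass K a b := by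
  rw [jointMass_self hpart]
  by_cases h : K.mass a = 0
  · rw [h, zero_mul, jointMass_eq hpart]
    refine (Finset.sum_eq_zero fun ω _ => ?_).symm
    split_ifs with hs
    · exact pi_eq_zero_of_mass_eq_zero h hs.1
    · rfl
  · field_simp

/-- Averaging over `π_ℓ` is averaging over a random facet and a random type. -/
lemma sum_level_mul (hpart : IsPartite K) (ℓ : ℕ) (φ : Finset (Fin n × U) → ℝ) :
    ∑ a, K.level ℓ a * φ a =
      ∑ ω, K.pi ω * ∑ S, unifSubsets n ℓ S * φ (restrict ω S) := by
  have h (ω : Finset (Fin n × U)) :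
      K.pi ω * ∑ S, unifSubsets n ℓ S * φ (restrict ω S) =
        K.pi ω * ∑ a, if a ⊆ ω then
          (if a.card = ℓ then (n.choose ℓ : ℝ)⁻¹ else 0) * φ a else 0 := by
    rw [pi_mul_sum_subset hpart ω fun a => (if a.card = ℓ then (n.choose ℓ : ℝ)⁻¹ else 0) * φ a]
    by_cases h0 : K.pi ω = 0
    · simp [h0]
    · simp only [card_restrict hpart h0, unifSubsets]
  simp_rw [h, Finset.mul_sum]
  rw [Finset.sum_comm]
  refine Finset.sum_congr rfl fun a _ => ?_
  unfold WComplex.level WComplex.mass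
  split_ifs with hc
  · rw [Finset.mul_sum, Finset.sum_mul]
    refine Finset.sum_congr rfl fun ω _ => ?_
    split_ifs <;> ring
  · simp

lemma inner'_expUpDown (hpart : IsPartite K) (ℓ : ℕ)
    (W : Finset (Fin n) → Finset (Fin n) → ℝ) (f g : Finset (Fin n × U) → ℝ) :
    inner' (K.level ℓ) f (mApp (expUpDown K W) g) =
      ∑ ω, K.pi ω * inner' (unifSubsets n ℓ) (fun S => f (restrict ω S))
        (mApp W fun S => g (restrict ω S)) := by
  set c : Finset (Fin n × U) → ℝ := fun a => if a.card = ℓ then (n.choose ℓ : ℝ)⁻¹ else 0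
    with hc
  have hlev (a b : Finset (Fin n × U)) : K.level ℓ a * expUpDown K W a b * (f a * g b) =
      ∑ ω, K.pi ω * if a ⊆ ω then
        if b ⊆ ω then c a * W (typ a) (typ b) * (f a * g b) else 0 else 0 := by
    have : K.level ℓ a = c a * K.mass a := by
      simp only [WComplex.level, hc, ite_mul, zero_mul]
    rw [this, expUpDown, show c a * K.mass a * (W (typ a) (typ b) *
      (jointMass K a b / jointMass K a a)) * (f a * g b) = (K.mass a *
      (jointMass K a b / jointMass K a a)) * (c a * W (typ a) (typ b) * (f a * g b)) by ring,
      mass_mul_jointMass_div hpart, jointMass_eq hpart, Finset.sum_mul]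
    refine Finset.sum_congr rfl fun ω _ => ?_
    by_cases ha : a ⊆ ω <;> by_cases hb : b ⊆ ω <;> simp [ha, hb]
  have hω (ω : Finset (Fin n × U)) :
      K.pi ω * inner' (unifSubsets n ℓ) (fun S => f (restrict ω S))
        (mApp W fun S => g (restrict ω S)) =
      K.pi ω * ∑ a, if a ⊆ ω then
        ∑ b, (if b ⊆ ω then c a * W (typ a) (typ b) * (f a * g b) else 0) else 0 := by
    rw [pi_mul_sum_subset hpart ω fun a =>
      ∑ b, (if b ⊆ ω then c a * W (typ a) (typ b) * (f a * g b) else 0), inner'_mApp]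
    rw [Finset.mul_sum, Finset.mul_sum]
    refine Finset.sum_congr rfl fun S _ => ?_
    rw [pi_mul_sum_subset hpart ω fun b =>
      c (restrict ω S) * W (typ (restrict ω S)) (typ b) * (f (restrict ω S) * g b)]
    by_cases h0 : K.pi ω = 0
    · simp [h0]
    · simp only [hc, card_restrict hpart h0, typ_restrict hpart h0, unifSubsets]
  rw [inner'_mApp, Finset.sum_congr rfl fun ω _ => hω ω]
  simp_rw [hlev]
  simp only [Finset.mul_sum (s := Finset.univ (α := Finset (Fin n × U)))]
  refine Eq.trans ?_ Finset.sum_comm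
  refine Finset.sum_congr rfl fun a _ => Finset.sum_comm.trans ?_
  refine Finset.sum_congr rfl fun ω _ => ?_
  by_cases ha : a ⊆ ω <;> simp [ha, Finset.mul_sum]

lemma inner'_upDown (hpart : IsPartite K) (ℓ : ℕ)
    (f g : Finset (Fin n × U) → ℝ) :
    inner' (K.level ℓ) f (mApp (K.upDown ℓ) g) =
      ∑ ω, K.pi ω * (expect (unifSubsets n ℓ) (fun S => f (restrict ω S)) *
        expect (unifSubsets n ℓ) (fun S => g (restrict ω S))) := by
  set c : Finset (Fin n × U) → ℝ := fun a => if a.card = ℓ then (n.choose ℓ : ℝ)⁻¹ else 0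
    with hc
  have hup (a ω : Finset (Fin n × U)) :
      K.level ℓ a * K.up ℓ n a ω = K.pi ω * if a ⊆ ω then c a else 0 := by
    by_cases hω : ω.card = n
    · by_cases ha : a.card = ℓ
      · by_cases hs : a ⊆ ω
        · by_cases hm : K.mass a = 0
          · simp [WComplex.level, hm, pi_eq_zero_of_mass_eq_zero hm hs]
          · simp only [WComplex.level, WComplex.up, hc, ha, hω, hs, and_self, if_true,
              Nat.choose_self, mass_of_card_eq hω]
            field_simp
            simp
        · simp [WComplex.up, hs]
      · simp [WComplex.up, hc, ha]
    · simp [WComplex.up, hω, K.pi_zero_of_card_ne ω hω]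
  have hω (ω : Finset (Fin n × U)) (φ : Finset (Fin n × U) → ℝ) :
      K.pi ω * ∑ a, (if a ⊆ ω then c a * φ a else 0) =
      K.pi ω * expect (unifSubsets n ℓ) (fun S => φ (restrict ω S)) := by
    rw [pi_mul_sum_subset hpart ω fun a => c a * φ a]
    by_cases h0 : K.pi ω = 0
    · simp [h0]
    · simp only [hc, card_restrict hpart h0, unifSubsets, expect]
  have hdown (ω : Finset (Fin n × U)) : K.pi ω * mApp (K.down n ℓ) g ω =
      K.pi ω * expect (unifSubsets n ℓ) (fun S => g (restrict ω S)) := by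
    rw [← hω]
    by_cases h0 : K.pi ω = 0
    · simp [h0]
    congr 1
    refine Finset.sum_congr rfl fun b _ => ?_
    by_cases hb : b.card = ℓ <;> by_cases hs : b ⊆ ω <;>
      simp [WComplex.down, hc, hb, hs, card_of_pi_ne_zero h0]
  have hcomp (a : Finset (Fin n × U)) :
      mApp (K.upDown ℓ) g a = ∑ ω, K.up ℓ n a ω * mApp (K.down n ℓ) g ω := by
    simp only [mApp, WComplex.upDown, matMul, Finset.sum_mul, Finset.mul_sum]
    rw [Finset.sum_comm]
    simp only [mul_assoc]
  calc
    _ = ∑ a, ∑ ω, K.pi ω * (if a ⊆ ω then c a * f a else 0) * mApp (K.down n ℓ) g ω := by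
      refine Finset.sum_congr rfl fun a _ => ?_
      rw [hcomp, Finset.mul_sum, Finset.mul_sum]
      refine Finset.sum_congr rfl fun ω _ => ?_
      rw [show K.level ℓ a * (f a * (K.up ℓ n a ω * mApp (K.down n ℓ) g ω)) =
        K.level ℓ a * K.up ℓ n a ω * f a * mApp (K.down n ℓ) g ω by ring, hup, mul_assoc (K.pi ω),
        ite_mul, zero_mul]
    _ = _ := by
      rw [Finset.sum_comm]
      refine Finset.sum_congr rfl fun ω _ => ?_
      rw [← Finset.sum_mul, ← Finset.mul_sum, hω, mul_right_comm, hdown]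
      ring

end Facets

lemma unifSubsets_nonneg (n ℓ : ℕ) (S : Finset (Fin n)) : 0 ≤ unifSubsets n ℓ S := by
  unfold unifSubsets
  split_ifs <;> positivity

lemma sum_unifSubsets {n ℓ : ℕ} (hℓ : ℓ ≤ n) : ∑ S, unifSubsets n ℓ S = 1 := by
  have hpos : ((n.choose ℓ : ℕ) : ℝ) ≠ 0 := by exact_mod_cast (Nat.choose_pos hℓ).ne'
  have hcard : (Finset.univ.filter fun S : Finset (Fin n) => S.card = ℓ).card = n.choose ℓ := by
    rw [Finset.univ_filter_card_eq, Finset.card_powersetCard, Finset.card_univ, Fintype.card_fin]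
  unfold unifSubsets
  rw [← Finset.sum_filter, Finset.sum_const, hcard, nsmul_eq_mul, mul_inv_cancel₀ hpos]

section Walk

variable {n ℓ k : ℕ} {H : SimpleGraph (Finset (Fin n))}

lemma walkMat_nonneg (S T : Finset (Fin n)) : 0 ≤ walkMat H k S T := by
  unfold walkMat
  split_ifs <;> positivity

lemma unifSubsets_mul_walkMat_comm (hreg : IsRegularOnSubsets H ℓ k) (S T : Finset (Fin n)) :
    unifSubsets n ℓ S * walkMat H k S T = unifSubsets n ℓ T * walkMat H k T S := by
  by_cases h : H.Adj S T
  · simp [unifSubsets, walkMat, h, h.symm, hreg.1 S T h]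
  · simp [walkMat, h, H.adj_comm T S]

lemma sum_walkMat (hreg : IsRegularOnSubsets H ℓ k) (hk : 0 < k) {S : Finset (Fin n)}
    (hS : unifSubsets n ℓ S ≠ 0) : ∑ T, walkMat H k S T = 1 := by
  have hc : S.card = ℓ := by
    by_contra h
    exact hS (by simp [unifSubsets, h])
  have hk' : (k : ℝ) ≠ 0 := by exact_mod_cast hk.ne'
  unfold walkMat
  rw [← Finset.sum_filter, Finset.sum_const, hreg.2 S hc, nsmul_eq_mul, mul_inv_cancel₀ hk']

end Walk

end Expanderized

open Expanderized WComplex in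
/-- The expanderized up-down walk `Papx = UpDown_{ℓ↔n}(X, π, H)`
approximates the usual up-down walk `Udw_{ℓ↔n}` in operator norm:
`‖Papx − (1 − λ(H))·Udw_{ℓ↔n}‖_{op, π_ℓ} ≤ λ(H)`. -/
theorem statement0 {n ℓ k : ℕ} {U : Type*} [Fintype U] [DecidableEq U]
    (K : WComplex (Fin n × U) n) (hpart : IsPartite K) (hℓ : ℓ ≤ n)
    (H : SimpleGraph (Finset (Fin n))) (hreg : IsRegularOnSubsets H ℓ k) (hk : 0 < k) :
    opNorm (K.level ℓ)
        (fun a b => expUpDown K (walkMat H k) a b - (1 - lamH H ℓ k) * K.upDown ℓ a b) ≤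
      lamH H ℓ k := by
  have hform (f g : Finset (Fin n × U) → ℝ) : inner' (K.level ℓ) f (mApp
      (fun a b => expUpDown K (walkMat H k) a b - (1 - lamH H ℓ k) * K.upDown ℓ a b) g) =
      ∑ ω, K.pi ω * (inner' (unifSubsets n ℓ) (fun S => f (restrict ω S))
          (mApp (walkMat H k) fun S => g (restrict ω S)) -
        (1 - lamH H ℓ k) * (expect (unifSubsets n ℓ) (fun S => f (restrict ω S)) *
          expect (unifSubsets n ℓ) (fun S => g (restrict ω S)))) := by
    have hsplit : inner' (K.level ℓ) f (mApp
        (fun a b => expUpDown K (walkMat H k) a b - (1 - lamH H ℓ k) * K.upDown ℓ a b) g) =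
        inner' (K.level ℓ) f (mApp (expUpDown K (walkMat H k)) g) -
          (1 - lamH H ℓ k) * inner' (K.level ℓ) f (mApp (K.upDown ℓ) g) := by
      simp only [inner'_mApp, Finset.mul_sum, ← Finset.sum_sub_distrib]
      exact Finset.sum_congr rfl fun x _ => Finset.sum_congr rfl fun y _ => by ring
    rw [hsplit, inner'_expUpDown hpart, inner'_upDown hpart, Finset.mul_sum,
      ← Finset.sum_sub_distrib]
    exact Finset.sum_congr rfl fun ω _ => by ring
  refine opNorm_le_of_quadratic twoSided_nonneg (level_nonneg ℓ) (fun f g => ?_) fun f => ?_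
  · rw [hform, hform]
    refine Finset.sum_congr rfl fun ω _ => ?_
    congr 2
    · rw [inner'_mApp, inner'_mApp, Finset.sum_comm]
      refine Finset.sum_congr rfl fun S _ => Finset.sum_congr rfl fun T _ => ?_
      rw [unifSubsets_mul_walkMat_comm hreg]
      ring
    · ring
  · rw [hform, inner', sum_level_mul hpart ℓ fun a => f a * f a, Finset.mul_sum]
    refine (Finset.abs_sum_le_sum_abs _ _).trans (Finset.sum_le_sum fun ω _ => ?_)
    rw [abs_mul, abs_of_nonneg (pi_nonneg K ω), mul_left_comm (lamH H ℓ k)]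
    exact mul_le_mul_of_nonneg_left (abs_inner'_mApp_sub_le (unifSubsets_nonneg n ℓ)
      (sum_unifSubsets hℓ) walkMat_nonneg (unifSubsets_mul_walkMat_comm hreg)
      (fun S hS => sum_walkMat hreg hk hS) fun S => f (restrict ω S)) (pi_nonneg K ω)
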